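/- For all n ≥ 1, the total degree of X_n equals n, and the total degree of Y_n equals ⌊3n/2⌋ (that is, 3n/2 when n is even and (3n−1)/2 when n is odd). Consequently the homogenization of the folding map G_n to a rational self-map of ℙ² has degree ⌊3n/2⌋. -/

import Mathlib

open MvPolynomial

set_option maxHeartbeats 1000000

/-- The first coordinates `X_n ∈ ℤ[x,y]` of the folding maps `G_n = 𝖥_n[𝒢₂]`
(with `X 0 = x`, `X 1 = y`), given by the initial values `X_0,…,X_5` and the recursion
`X_{n+6} = x(X_{n+5}+X_{n+1}) − (x+y+3)(X_{n+4}+X_{n+2}) + (x²−2y−4)X_{n+3} − X_n`. -/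
noncomputable def XG : ℕ → MvPolynomial (Fin 2) ℤ
  | 0 => 6
  | 1 => X 0
  | 2 => X 0 ^ 2 - 2 * X 0 - 2 * X 1 - 6
  | 3 => X 0 ^ 3 - 3 * X 0 * X 1 - 9 * X 0 - 6 * X 1 - 12
  | 4 => X 0 ^ 4 - 4 * X 0 ^ 2 * X 1 - 10 * X 0 ^ 2 - 4 * X 0 * X 1 + 2 * X 1 ^ 2
      - 8 * X 0 + 8 * X 1 + 6
  | 5 => X 0 ^ 5 - 5 * X 0 ^ 3 * X 1 - 15 * X 0 ^ 3 - 5 * X 0 ^ 2 * X 1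
      + 5 * X 0 * X 1 ^ 2 - 10 * X 0 ^ 2 + 35 * X 0 * X 1 + 10 * X 1 ^ 2
      + 55 * X 0 + 50 * X 1 + 60
  | n + 6 => X 0 * (XG (n + 5) + XG (n + 1)) - (X 0 + X 1 + 3) * (XG (n + 4) + XG (n + 2))
      + (X 0 ^ 2 - 2 * X 1 - 4) * XG (n + 3) - XG n

/-- The second coordinates `Y_n ∈ ℤ[x,y]` of the folding maps `G_n = 𝖥_n[𝒢₂]`
(with `X 0 = x`, `X 1 = y`), given by the initial values `Y_0,…,Y_5` and the recursion
`Y_{n+6} = y(Y_{n+5}+Y_{n+1}) − (x³−3xy−9x−5y−9)(Y_{n+4}+Y_{n+2})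
+ (y²−2x³+6xy+18x+12y+8)Y_{n+3} − Y_n`. -/
noncomputable def YG : ℕ → MvPolynomial (Fin 2) ℤ
  | 0 => 6
  | 1 => X 1
  | 2 => -2 * X 0 ^ 3 + 6 * X 0 * X 1 + X 1 ^ 2 + 18 * X 0 + 10 * X 1 + 18
  | 3 => -3 * X 0 ^ 3 * X 1 - 6 * X 0 ^ 3 + 9 * X 0 * X 1 ^ 2 + X 1 ^ 3
      + 45 * X 0 * X 1 + 18 * X 1 ^ 2 + 54 * X 0 + 63 * X 1 + 60
  | 4 => 2 * X 0 ^ 6 - 12 * X 0 ^ 4 * X 1 - 4 * X 0 ^ 3 * X 1 ^ 2 - 36 * X 0 ^ 4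
      - 28 * X 0 ^ 3 * X 1 + 18 * X 0 ^ 2 * X 1 ^ 2 + 12 * X 0 * X 1 ^ 3 + X 1 ^ 4
      - 40 * X 0 ^ 3 + 108 * X 0 ^ 2 * X 1 + 120 * X 0 * X 1 ^ 2 + 24 * X 1 ^ 3
      + 162 * X 0 ^ 2 + 372 * X 0 * X 1 + 134 * X 1 ^ 2 + 360 * X 0 + 280 * X 1 + 198
  | 5 => 5 * X 0 ^ 6 * X 1 + 10 * X 0 ^ 6 - 30 * X 0 ^ 4 * X 1 ^ 2 - 5 * X 0 ^ 3 * X 1 ^ 3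
      - 150 * X 0 ^ 4 * X 1 - 65 * X 0 ^ 3 * X 1 ^ 2 + 45 * X 0 ^ 2 * X 1 ^ 3
      + 15 * X 0 * X 1 ^ 4 + X 1 ^ 5 - 180 * X 0 ^ 4 - 205 * X 0 ^ 3 * X 1
      + 360 * X 0 ^ 2 * X 1 ^ 2 + 240 * X 0 * X 1 ^ 3 + 30 * X 1 ^ 4 - 190 * X 0 ^ 3
      + 945 * X 0 ^ 2 * X 1 + 1200 * X 0 * X 1 ^ 2 + 255 * X 1 ^ 3 + 810 * X 0 ^ 2
      + 2415 * X 0 * X 1 + 920 * X 1 ^ 2 + 1710 * X 0 + 1495 * X 1 + 900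
  | n + 6 => X 1 * (YG (n + 5) + YG (n + 1))
      - (X 0 ^ 3 - 3 * X 0 * X 1 - 9 * X 0 - 5 * X 1 - 9) * (YG (n + 4) + YG (n + 2))
      + (X 1 ^ 2 - 2 * X 0 ^ 3 + 6 * X 0 * X 1 + 18 * X 0 + 12 * X 1 + 8) * YG (n + 3)
      - YG n

namespace MvPolynomial

section TotalDegreeAddMul

variable {σ R : Type*} [CommSemiring R] {p q : MvPolynomial σ R} {a b d : ℕ}

theorem totalDegree_add_le_of_le (hp : p.totalDegree ≤ d) (hq : q.totalDegree ≤ d) :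
    (p + q).totalDegree ≤ d :=
  (totalDegree_add p q).trans (max_le hp hq)

theorem totalDegree_mul_le_of_le (hp : p.totalDegree ≤ a) (hq : q.totalDegree ≤ b)
    (h : a + b ≤ d) : (p * q).totalDegree ≤ d :=
  (totalDegree_mul p q).trans ((add_le_add hp hq).trans h)

theorem totalDegree_ofNat_le (n : ℕ) [n.AtLeastTwo] :
    (OfNat.ofNat n : MvPolynomial σ R).totalDegree ≤ 0 := by
  rw [← map_ofNat C n, totalDegree_C]

end TotalDegreeAddMul

section TotalDegreeSub

variable {σ R : Type*} [CommRing R] {p q : MvPolynomial σ R} {d : ℕ}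

theorem totalDegree_sub_le_of_le (hp : p.totalDegree ≤ d) (hq : q.totalDegree ≤ d) :
    (p - q).totalDegree ≤ d :=
  (totalDegree_sub p q).trans (max_le hp hq)

theorem totalDegree_neg_le_of_le (hp : p.totalDegree ≤ d) : (-p).totalDegree ≤ d :=
  (totalDegree_neg p).trans_le hp

theorem totalDegree_eq_of_sub_lt (h : (p - q).totalDegree < q.totalDegree) :
    p.totalDegree = q.totalDegree := by
  rw [← totalDegree_add_eq_left_of_totalDegree_lt h, add_sub_cancel]

end TotalDegreeSub

end MvPolynomial

/-- Degree bounds for the initial terms and the coefficients of both recursions, and for the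
initial instances of the relations `X_{n+1} ∼ x X_n`, and `Y_{n+2} ∼ -x³ Y_n` for even `n`,
`Y_{n+2} ∼ y Y_{n+1} - x³ Y_n` for odd `n`, between leading forms. -/
theorem totalDegree_initial_le :
    (∀ n < 6, (XG n).totalDegree ≤ n) ∧ (∀ n < 6, (YG n).totalDegree ≤ 3 * n / 2) ∧
    (X 0 + X 1 + 3 : MvPolynomial (Fin 2) ℤ).totalDegree ≤ 1 ∧
    (X 0 ^ 2 - 2 * X 1 - 4 : MvPolynomial (Fin 2) ℤ).totalDegree ≤ 2 ∧
    (3 * X 0 * X 1 + 9 * X 0 + 5 * X 1 + 9 : MvPolynomial (Fin 2) ℤ).totalDegree ≤ 2 ∧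
    (X 0 ^ 3 - 3 * X 0 * X 1 - 9 * X 0 - 5 * X 1 - 9 :
      MvPolynomial (Fin 2) ℤ).totalDegree ≤ 3 ∧
    (X 1 ^ 2 - 2 * X 0 ^ 3 + 6 * X 0 * X 1 + 18 * X 0 + 12 * X 1 + 8 :
      MvPolynomial (Fin 2) ℤ).totalDegree ≤ 3 ∧
    (∀ n < 4, (XG (n + 2) - X 0 * XG (n + 1)).totalDegree ≤ n + 1) ∧
    (YG 2 + 2 * X 0 ^ 3).totalDegree ≤ 2 ∧ (YG 4 + X 0 ^ 3 * YG 2).totalDegree ≤ 5 ∧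
    (YG 3 + 3 * (X 0 ^ 3 * X 1)).totalDegree ≤ 3 ∧
    (YG 5 - X 1 * YG 4 + X 0 ^ 3 * YG 3).totalDegree ≤ 6 := by
  refine ⟨?_, ?_, ?_, ?_, ?_, ?_, ?_, ?_, ?_, ?_, ?_, ?_⟩
  all_goals
    try (intro n hn; interval_cases n)
  all_goals
    try simp only [XG, YG]
    ring_nf
    repeat' with_reducible_and_instances first
      | exact totalDegree_ofNat_le _
      | exact (totalDegree_X _).le
      | exact (totalDegree_X_pow _ _).le
      | apply totalDegree_add_le_of_le
      | apply totalDegree_sub_le_of_le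
      | apply totalDegree_neg_le_of_le
      | apply totalDegree_mul_le_of_le
      | refine (totalDegree_ofNat_le _).trans ?_
      | refine (totalDegree_X _).le.trans ?_
      | refine (totalDegree_X_pow _ _).le.trans ?_
      | exact le_rfl
      | decide

theorem totalDegree_XG_le (n : ℕ) : (XG n).totalDegree ≤ n := by
  obtain ⟨h0, -, h1, h2, -⟩ := totalDegree_initial_le
  induction n using Nat.strong_induction_on with
  | _ n ih =>
  obtain hn | ⟨m, rfl⟩ : n < 6 ∨ ∃ m, n = m + 6 := by
    by_cases h : n < 6
    · exact .inl h
    · exact .inr ⟨n - 6, by lia⟩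
  · exact h0 n hn
  have ih' (i : ℕ) (hi : i < 6) : (XG (m + i)).totalDegree ≤ m + 5 :=
    (ih (m + i) (by lia)).trans (by lia)
  rw [XG]
  refine totalDegree_sub_le_of_le (totalDegree_add_le_of_le (totalDegree_sub_le_of_le
    (totalDegree_mul_le_of_le (b := m + 5) (totalDegree_X _).le ?_ (by lia))
    (totalDegree_mul_le_of_le (b := m + 5) h1 ?_ (by lia)))
    (totalDegree_mul_le_of_le (b := m + 3) h2 (ih _ (by lia)) (by lia)))
    ((ih m (by lia)).trans (by lia))
  · exact totalDegree_add_le_of_le (ih' 5 (by lia)) (ih' 1 (by lia))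
  · exact totalDegree_add_le_of_le (ih' 4 (by lia)) (ih' 2 (by lia))

theorem totalDegree_XG_sub_le (n : ℕ) :
    (XG (n + 2) - X 0 * XG (n + 1)).totalDegree ≤ n + 1 := by
  obtain ⟨-, -, h1, h2, -, -, -, h, -⟩ := totalDegree_initial_le
  obtain hn | ⟨m, rfl⟩ : n < 4 ∨ ∃ m, n = m + 4 := by
    by_cases h : n < 4
    · exact .inl h
    · exact .inr ⟨n - 4, by lia⟩
  · exact h n hn
  have hX (i : ℕ) (hi : i < 5) : (XG (m + i)).totalDegree ≤ m + 4 :=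
    (totalDegree_XG_le (m + i)).trans (by lia)
  have key : XG (m + 4 + 2) - X 0 * XG (m + 4 + 1) =
      X 0 * XG (m + 1) - (X 0 + X 1 + 3) * (XG (m + 4) + XG (m + 2))
      + (X 0 ^ 2 - 2 * X 1 - 4) * XG (m + 3) - XG m := by
    rw [XG]
    ring
  rw [key]
  exact totalDegree_sub_le_of_le (totalDegree_add_le_of_le (totalDegree_sub_le_of_le
    (totalDegree_mul_le_of_le (totalDegree_X _).le (hX 1 (by lia)) (by lia))
    (totalDegree_mul_le_of_le h1
      (totalDegree_add_le_of_le (hX 4 (by lia)) (hX 2 (by lia))) (by lia)))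
    (totalDegree_mul_le_of_le h2 (totalDegree_XG_le (m + 3)) (by lia)))
    ((hX 0 (by lia)).trans (by lia))

theorem totalDegree_XG_sub_pow_le (n : ℕ) : (XG (n + 1) - X 0 ^ (n + 1)).totalDegree ≤ n := by
  induction n with
  | zero => simp [XG]
  | succ n ih =>
    have key : XG (n + 2) - X 0 ^ (n + 2) =
        (XG (n + 2) - X 0 * XG (n + 1)) + X 0 * (XG (n + 1) - X 0 ^ (n + 1)) := by ring
    rw [key]
    exact totalDegree_add_le_of_le (totalDegree_XG_sub_le n)
      (totalDegree_mul_le_of_le (totalDegree_X _).le ih (by lia))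

theorem totalDegree_YG_le (n : ℕ) : (YG n).totalDegree ≤ 3 * n / 2 := by
  obtain ⟨-, h0, -, -, -, h1, h2, -⟩ := totalDegree_initial_le
  induction n using Nat.strong_induction_on with
  | _ n ih =>
  obtain hn | ⟨m, rfl⟩ : n < 6 ∨ ∃ m, n = m + 6 := by
    by_cases h : n < 6
    · exact .inl h
    · exact .inr ⟨n - 6, by lia⟩
  · exact h0 n hn
  have ih' (i j : ℕ) (hi : i < 6) (hij : i ≤ j) : (YG (m + i)).totalDegree ≤ 3 * (m + j) / 2 :=
    (ih (m + i) (by lia)).trans (by lia)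
  rw [YG]
  exact totalDegree_sub_le_of_le (totalDegree_add_le_of_le (totalDegree_sub_le_of_le
    (totalDegree_mul_le_of_le (totalDegree_X _).le (totalDegree_add_le_of_le
      (ih' 5 5 (by lia) (by lia)) (ih' 1 5 (by lia) (by lia))) (by lia))
    (totalDegree_mul_le_of_le h1 (totalDegree_add_le_of_le
      (ih' 4 4 (by lia) (by lia)) (ih' 2 4 (by lia) (by lia))) (by lia)))
    (totalDegree_mul_le_of_le h2 (ih' 3 3 (by lia) (by lia)) (by lia)))
    (ih' 0 6 (by lia) (by lia))

theorem totalDegree_YG_even_add_le (k : ℕ) :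
    (YG (2 * k + 4) + X 0 ^ 3 * YG (2 * k + 2)).totalDegree ≤ 3 * k + 5 := by
  obtain ⟨-, -, -, -, h1, -, h2, -, -, h, -⟩ := totalDegree_initial_le
  cases k with
  | zero => exact h
  | succ k =>
    have hY (i d : ℕ) (hd : 3 * (2 * k + i) / 2 ≤ d) : (YG (2 * k + i)).totalDegree ≤ d :=
      (totalDegree_YG_le _).trans hd
    have key : YG (2 * k + 6) + X 0 ^ 3 * YG (2 * k + 4) =
        X 1 * (YG (2 * k + 5) + YG (2 * k + 1))
        + (3 * X 0 * X 1 + 9 * X 0 + 5 * X 1 + 9) * (YG (2 * k + 4) + YG (2 * k + 2))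
        - X 0 ^ 3 * YG (2 * k + 2)
        + (X 1 ^ 2 - 2 * X 0 ^ 3 + 6 * X 0 * X 1 + 18 * X 0 + 12 * X 1 + 8) * YG (2 * k + 3)
        - YG (2 * k) := by
      rw [YG]
      ring
    rw [show 2 * (k + 1) + 4 = 2 * k + 6 by ring, show 2 * (k + 1) + 2 = 2 * k + 4 by ring, key]
    exact totalDegree_sub_le_of_le (totalDegree_add_le_of_le (totalDegree_sub_le_of_le
      (totalDegree_add_le_of_le
        (totalDegree_mul_le_of_le (b := 3 * k + 7) (totalDegree_X _).le
          (totalDegree_add_le_of_le (hY 5 _ (by lia)) (hY 1 _ (by lia))) (by lia))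
        (totalDegree_mul_le_of_le (b := 3 * k + 6) h1
          (totalDegree_add_le_of_le (hY 4 _ (by lia)) (hY 2 _ (by lia))) (by lia)))
      (totalDegree_mul_le_of_le (b := 3 * k + 3) (totalDegree_X_pow _ _).le
        (hY 2 _ (by lia)) (by lia)))
      (totalDegree_mul_le_of_le (b := 3 * k + 4) h2 (hY 3 _ (by lia)) (by lia)))
      (hY 0 _ (by lia))

theorem totalDegree_YG_odd_add_le (k : ℕ) :
    (YG (2 * k + 5) - X 1 * YG (2 * k + 4) + X 0 ^ 3 * YG (2 * k + 3)).totalDegree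
      ≤ 3 * k + 6 := by
  obtain ⟨-, -, -, -, h1, -, h2, -, -, -, -, h⟩ := totalDegree_initial_le
  cases k with
  | zero => exact h
  | succ k =>
    have hY (i d : ℕ) (hd : 3 * (2 * k + i) / 2 ≤ d) : (YG (2 * k + i)).totalDegree ≤ d :=
      (totalDegree_YG_le _).trans hd
    have key : YG (2 * k + 7) - X 1 * YG (2 * k + 6) + X 0 ^ 3 * YG (2 * k + 5) =
        X 1 * YG (2 * k + 2)
        + (3 * X 0 * X 1 + 9 * X 0 + 5 * X 1 + 9) * (YG (2 * k + 5) + YG (2 * k + 3))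
        - X 0 ^ 3 * YG (2 * k + 3)
        + (X 1 ^ 2 - 2 * X 0 ^ 3 + 6 * X 0 * X 1 + 18 * X 0 + 12 * X 1 + 8) * YG (2 * k + 4)
        - YG (2 * k + 1) := by
      rw [show 2 * k + 7 = 2 * k + 1 + 6 by ring, YG.eq_7 (2 * k + 1)]
      ring
    rw [show 2 * (k + 1) + 5 = 2 * k + 7 by ring, show 2 * (k + 1) + 4 = 2 * k + 6 by ring,
      show 2 * (k + 1) + 3 = 2 * k + 5 by ring, key]
    exact totalDegree_sub_le_of_le (totalDegree_add_le_of_le (totalDegree_sub_le_of_le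
      (totalDegree_add_le_of_le
        (totalDegree_mul_le_of_le (b := 3 * k + 3) (totalDegree_X _).le
          (hY 2 _ (by lia)) (by lia))
        (totalDegree_mul_le_of_le (b := 3 * k + 7) h1
          (totalDegree_add_le_of_le (hY 5 _ (by lia)) (hY 3 _ (by lia))) (by lia)))
      (totalDegree_mul_le_of_le (b := 3 * k + 4) (totalDegree_X_pow _ _).le
        (hY 3 _ (by lia)) (by lia)))
      (totalDegree_mul_le_of_le (b := 3 * k + 6) h2 (hY 4 _ (by lia)) (by lia)))
      (hY 1 _ (by lia))

theorem totalDegree_YG_even_sub_le (k : ℕ) :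
    (YG (2 * k + 2) - C (2 * (-1) ^ (k + 1)) * X 0 ^ (3 * k + 3)).totalDegree ≤ 3 * k + 2 := by
  induction k with
  | zero =>
    obtain ⟨-, -, -, -, -, -, -, -, h, -⟩ := totalDegree_initial_le
    simpa using h
  | succ k ih =>
    have key : YG (2 * k + 4) - C (2 * (-1) ^ (k + 2)) * X 0 ^ (3 * k + 6) =
        (YG (2 * k + 4) + X 0 ^ 3 * YG (2 * k + 2))
        - X 0 ^ 3 * (YG (2 * k + 2) - C (2 * (-1) ^ (k + 1)) * X 0 ^ (3 * k + 3)) := by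
      simp only [map_mul, map_pow, map_neg, map_one]
      ring
    exact key ▸ totalDegree_sub_le_of_le (totalDegree_YG_even_add_le k)
      (totalDegree_mul_le_of_le (totalDegree_X_pow _ _).le ih (by lia))

theorem totalDegree_YG_odd_sub_le (k : ℕ) :
    (YG (2 * k + 3) - C ((-1) ^ (k + 1) * (2 * (k : ℤ) + 3)) * (X 0 ^ (3 * k + 3) * X 1)).totalDegree
      ≤ 3 * k + 3 := by
  induction k with
  | zero =>
    obtain ⟨-, -, -, -, -, -, -, -, -, -, h, -⟩ := totalDegree_initial_le
    simpa using h
  | succ k ih =>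
    have key : YG (2 * k + 5)
          - C ((-1) ^ (k + 2) * (2 * ((k + 1 : ℕ) : ℤ) + 3)) * (X 0 ^ (3 * k + 6) * X 1) =
        (YG (2 * k + 5) - X 1 * YG (2 * k + 4) + X 0 ^ 3 * YG (2 * k + 3))
        + X 1 * (YG (2 * k + 4) - C (2 * (-1) ^ (k + 2)) * X 0 ^ (3 * k + 6))
        - X 0 ^ 3 * (YG (2 * k + 3)
          - C ((-1) ^ (k + 1) * (2 * (k : ℤ) + 3)) * (X 0 ^ (3 * k + 3) * X 1)) := by
      simp only [map_mul, map_pow, map_neg, map_one, map_add, Nat.cast_add, Nat.cast_one,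
        map_ofNat]
      ring
    exact key ▸ totalDegree_sub_le_of_le (totalDegree_add_le_of_le (totalDegree_YG_odd_add_le k)
      (totalDegree_mul_le_of_le (totalDegree_X _).le (totalDegree_YG_even_sub_le (k + 1))
        (by lia)))
      (totalDegree_mul_le_of_le (totalDegree_X_pow _ _).le ih (by lia))

theorem totalDegree_YG_even (k : ℕ) : (YG (2 * k + 2)).totalDegree = 3 * k + 3 := by
  have hd : (C (2 * (-1) ^ (k + 1)) * X 0 ^ (3 * k + 3) :
      MvPolynomial (Fin 2) ℤ).totalDegree = 3 * k + 3 := by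
    rw [totalDegree_mul_of_isDomain (by simp) (by simp), totalDegree_C, totalDegree_X_pow,
      zero_add]
  have h := totalDegree_YG_even_sub_le k
  exact (totalDegree_eq_of_sub_lt (by lia)).trans hd

theorem totalDegree_YG_odd (k : ℕ) : (YG (2 * k + 3)).totalDegree = 3 * k + 4 := by
  have hd : (C ((-1) ^ (k + 1) * (2 * (k : ℤ) + 3)) * (X 0 ^ (3 * k + 3) * X 1) :
      MvPolynomial (Fin 2) ℤ).totalDegree = 3 * k + 4 := by
    have hc : (-1 : ℤ) ^ (k + 1) * (2 * k + 3) ≠ 0 := mul_ne_zero (by simp) (by positivity)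
    rw [totalDegree_mul_of_isDomain (by simpa only [ne_eq, C_eq_zero] using hc) (by simp),
      totalDegree_mul_of_isDomain (by simp) (by simp),
      totalDegree_C, totalDegree_X_pow, totalDegree_X, zero_add]
  have h := totalDegree_YG_odd_sub_le k
  exact (totalDegree_eq_of_sub_lt (by lia)).trans hd

/-- For `n ≥ 1`, the total degree of `X_n` equals `n` and the total degree of `Y_n`
equals `⌊3n/2⌋`.  Consequently the homogenization of the folding map `G_n` to a
rational self-map of `ℙ²` has degree `⌊3n/2⌋`. -/
theorem G_degrees (n : ℕ) (hn : 1 ≤ n) :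
    (XG n).totalDegree = n ∧ (YG n).totalDegree = 3 * n / 2 := by
  constructor
  · obtain ⟨m, rfl⟩ := Nat.exists_eq_add_of_le' hn
    have hd := totalDegree_X_pow (R := ℤ) (0 : Fin 2) (m + 1)
    have h := totalDegree_XG_sub_pow_le m
    exact (totalDegree_eq_of_sub_lt (by lia)).trans hd
  · obtain rfl | ⟨k, rfl | rfl⟩ : n = 1 ∨ ∃ k, n = 2 * k + 2 ∨ n = 2 * k + 3 := by
      by_cases h : n = 1
      · exact .inl h
      · exact .inr ⟨(n - 2) / 2, by lia⟩
    · rw [YG, totalDegree_X]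
    · rw [totalDegree_YG_even]
      lia
    · rw [totalDegree_YG_odd]
      lia
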